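/- Let M₄ be the 16×16 integer matrix of the previous statement and let L = {(1/4)·v : v in the ℤ-span of the rows of M₄} ⊆ ℚ¹⁶. Then the number of vectors x ∈ L with x₁² + x₂² + ⋯ + x₁₆² = 1 is exactly 4320. -/

import Mathlib

/-- The rows of the generator matrix `M₄` of (4 times) the lattice `Λ` of the paper. -/
def M4rows : Fin 16 → Fin 16 → ℤ :=
  ![![1,1,1,1,1,1,1,1,1,1,1,1,1,1,1,1],
    ![0,2,0,0,0,0,0,2,0,0,0,2,0,2,0,0],
    ![0,0,2,0,0,0,0,2,0,0,0,2,0,0,2,0],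
    ![0,0,0,2,0,0,0,2,0,0,0,2,0,0,0,2],
    ![0,0,0,0,2,0,0,2,0,0,0,0,0,2,2,0],
    ![0,0,0,0,0,2,0,2,0,0,0,0,0,2,0,2],
    ![0,0,0,0,0,0,2,2,0,0,0,0,0,0,2,2],
    ![0,0,0,0,0,0,0,4,0,0,0,0,0,0,0,0],
    ![0,0,0,0,0,0,0,0,2,0,0,2,0,2,2,0],
    ![0,0,0,0,0,0,0,0,0,2,0,2,0,2,0,2],
    ![0,0,0,0,0,0,0,0,0,0,2,2,0,0,2,2],
    ![0,0,0,0,0,0,0,0,0,0,0,4,0,0,0,0],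
    ![0,0,0,0,0,0,0,0,0,0,0,0,2,2,2,2],
    ![0,0,0,0,0,0,0,0,0,0,0,0,0,4,0,0],
    ![0,0,0,0,0,0,0,0,0,0,0,0,0,0,4,0],
    ![0,0,0,0,0,0,0,0,0,0,0,0,0,0,0,4]]

/-- Columns of a parity check matrix of the Reed–Muller code `RM(2, 4)`. -/
def checkColumn (i : Fin 16) : Fin 5 → ZMod 2 :=
  ![![1,1,1,1,1,1,1,1,0,0,0,0,0,0,0,0] i,
    ![1,1,1,1,0,0,0,0,1,1,1,1,0,0,0,0] i,
    ![1,1,0,0,1,1,0,0,1,1,0,0,1,1,0,0] i,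
    ![1,0,1,0,1,0,1,0,1,0,1,0,1,0,1,0] i,
    ![1,0,0,1,0,1,1,0,0,1,1,0,1,0,0,1] i]

/-- The syndrome map of `RM(2, 4)` on integer words. -/
def syndrome (w : Fin 16 → ℤ) : Fin 5 → ZMod 2 :=
  ∑ i, (w i : ZMod 2) • checkColumn i

theorem card_fin_succ_subtype {α : Type*} {n : ℕ} (A : Finset α) (p : (Fin (n + 1) → α) → Prop)
    (hA : ∀ w, p w → w 0 ∈ A) (hfin : ∀ a, Finite {w : Fin n → α // p (Fin.cons a w)}) :
    Nat.card {w // p w} = ∑ a ∈ A, Nat.card {w : Fin n → α // p (Fin.cons a w)} := by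
  rw [← Finset.sum_coe_sort A, ← Nat.card_sigma]
  refine Nat.card_congr
    { toFun := fun w => ⟨⟨w.1 0, hA _ w.2⟩, Fin.tail w.1, by simpa using w.2⟩
      invFun := fun x => ⟨Fin.cons x.1.1 x.2.1, x.2.2⟩
      left_inv := fun w => by simp
      right_inv := fun _ => rfl }

theorem finite_sum_sq_le {n : ℕ} (r : ℤ) (p : (Fin n → ℤ) → Prop)
    (hp : ∀ w, p w → ∑ i, w i ^ 2 ≤ r) : Finite {w // p w} := by
  refine Set.Finite.subset (Set.Finite.pi' fun _ : Fin n => Set.finite_Icc (-r) r) ?_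
  intro w hw i
  have h : w i ^ 2 ≤ ∑ j, w j ^ 2 :=
    Finset.single_le_sum (f := fun j => w j ^ 2) (fun j _ => sq_nonneg _) (Finset.mem_univ i)
  have h' := hp w hw
  constructor <;> nlinarith [Int.le_self_sq (w i), Int.le_self_sq (-w i)]

/-- A recursive count of the integer words of squared length `r ≤ 4` whose syndrome with respect
to the given columns is `s`. -/
def shortWordCount {G : Type*} [AddCommGroup G] [DecidableEq G] : List G → ℕ → G → ℕ
  | [], r, s => if r = 0 ∧ s = 0 then 1 else 0
  | h :: t, r, s =>
    shortWordCount t r s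
      + (if 1 ≤ r then 2 * shortWordCount t (r - 1) (s + h) else 0)
      + (if 4 ≤ r then 2 * shortWordCount t (r - 4) s else 0)

theorem card_shortWords {G : Type*} [AddCommGroup G] [DecidableEq G] [Module (ZMod 2) G] {n : ℕ}
    (h : Fin n → G) {r : ℕ} (hr : r ≤ 4) (s : G) :
    Nat.card {w : Fin n → ℤ // ∑ i, w i ^ 2 = r ∧ s + ∑ i, (w i : ZMod 2) • h i = 0}
      = shortWordCount (List.ofFn h) r s := by
  induction n generalizing r s with
  | zero =>
    by_cases hs : r = 0 ∧ s = 0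
    · simp [shortWordCount, hs]
    · have : IsEmpty {w : Fin 0 → ℤ // ∑ i, w i ^ 2 = r ∧ s + ∑ i, (w i : ZMod 2) • h i = 0} :=
        ⟨fun w => hs (by simpa [eq_comm] using w.2)⟩
      rw [Nat.card_of_isEmpty]
      simp [shortWordCount, hs]
  | succ n ih =>
    rw [card_fin_succ_subtype (Finset.Icc (-2) 2)]
    · have key (a : ℤ) (b : ℕ) (z : ZMod 2) (hb : a ^ 2 = b) (hz : (a : ZMod 2) = z) :
          Nat.card {w : Fin n → ℤ // ∑ i, (Fin.cons a w : Fin (n + 1) → ℤ) i ^ 2 = r ∧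
            s + ∑ i, ((Fin.cons a w : Fin (n + 1) → ℤ) i : ZMod 2) • h i = 0}
          = if b ≤ r then shortWordCount (List.ofFn fun i : Fin n => h i.succ) (r - b)
              (s + z • h 0) else 0 := by
        simp only [Fin.sum_univ_succ, Fin.cons_zero, Fin.cons_succ, hb, hz]
        split_ifs with hbr
        · rw [← ih _ (by omega)]
          refine Nat.card_congr (Equiv.subtypeEquivRight fun w => ?_)
          rw [Nat.cast_sub hbr, add_assoc, eq_sub_iff_add_eq']
        · have : IsEmpty {w : Fin n → ℤ // (b : ℤ) + ∑ i, w i ^ 2 = r ∧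
              s + (z • h 0 + ∑ i, (w i : ZMod 2) • h i.succ) = 0} := by
            refine ⟨fun w => hbr ?_⟩
            have h0 : 0 ≤ ∑ i, w.1 i ^ 2 := Finset.sum_nonneg fun i _ => sq_nonneg _
            have h1 := w.2.1
            omega
          simp
      have hIcc : Finset.Icc (-2 : ℤ) 2 = {-2, -1, 0, 1, 2} := by decide
      rw [hIcc, Finset.sum_insert (by decide), Finset.sum_insert (by decide),
        Finset.sum_insert (by decide), Finset.sum_insert (by decide), Finset.sum_singleton,
        key (-2) 4 0 (by norm_num) (by decide), key (-1) 1 1 (by norm_num) (by decide),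
        key 0 0 0 (by norm_num) (by decide), key 1 1 1 (by norm_num) (by decide),
        key 2 4 0 (by norm_num) (by decide), List.ofFn_succ, shortWordCount]
      simp only [zero_smul, one_smul, add_zero, Nat.zero_le, if_true, Nat.sub_zero]
      split_ifs <;> ring
    · rintro w ⟨hw, -⟩
      have h1 : w 0 ^ 2 ≤ ∑ j, w j ^ 2 :=
        Finset.single_le_sum (f := fun j => w j ^ 2) (fun j _ => sq_nonneg _) (Finset.mem_univ 0)
      have h2 : (r : ℤ) ≤ 4 := by exact_mod_cast hr
      rw [Finset.mem_Icc]
      constructor <;> nlinarith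
    · refine fun a => finite_sum_sq_le r _ fun w hw => ?_
      have h1 := hw.1
      simp only [Fin.sum_univ_succ, Fin.cons_zero, Fin.cons_succ] at h1
      nlinarith [sq_nonneg a]

theorem card_even_words :
    Nat.card {w : Fin 16 → ℤ // ∑ i, w i ^ 2 = 4 ∧ syndrome w = 0} = 2272 := by
  have h := card_shortWords checkColumn (le_refl 4) 0
  simp only [zero_add] at h
  refine h.trans ?_
  decide +kernel

theorem card_ker_syndrome :
    Nat.card {z : Fin 16 → ZMod 2 // ∑ i, z i • checkColumn i = 0} = 2048 := by
  have hcard : Nat.card (LinearMap.ker (Fintype.linearCombination (ZMod 2) checkColumn)) = 2048 := by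
    have hsurj : Function.Surjective (Fintype.linearCombination (ZMod 2) checkColumn) := by
      intro y
      refine ⟨![0,0,0,0,0,0,0,y 0,0,0,0,y 1,0,y 2,y 3,y 4], ?_⟩
      ext k
      fin_cases k <;>
        simp [Fintype.linearCombination_apply, Fin.sum_univ_succ, checkColumn]
    have h := LinearMap.finrank_range_add_finrank_ker
      (Fintype.linearCombination (ZMod 2) checkColumn)
    rw [LinearMap.range_eq_top.2 hsurj, finrank_top] at h
    simp only [Module.finrank_fin_fun] at h
    rw [Module.natCard_eq_pow_finrank (K := ZMod 2), Nat.card_zmod,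
      show Module.finrank (ZMod 2) _ = 11 by omega]
    norm_num
  rw [← hcard]
  exact Nat.card_congr (Equiv.subtypeEquivRight fun z => by
    simp [Fintype.linearCombination_apply])

theorem card_odd_words :
    Nat.card {w : Fin 16 → ℤ // ∑ i, (w i ^ 2 + w i) = 0 ∧ syndrome w = 0} = 2048 := by
  rw [← card_ker_syndrome]
  have hnn (a : ℤ) : 0 ≤ a ^ 2 + a := by nlinarith [Int.le_self_sq (-a)]
  have hval : ∀ a : ZMod 2, (-(a.val : ℤ)) ^ 2 + -(a.val : ℤ) = 0 ∧
      ((-(a.val : ℤ) : ℤ) : ZMod 2) = a := by decide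
  refine Nat.card_congr
    { toFun := fun w => ⟨fun i => (w.1 i : ZMod 2), w.2.2⟩
      invFun := fun z => ⟨fun i => -((z.1 i).val : ℤ),
        Finset.sum_eq_zero fun i _ => (hval _).1, by
          simpa only [syndrome, (hval _).2] using z.2⟩
      left_inv := fun w => ?_
      right_inv := fun z => Subtype.ext (funext fun i => (hval _).2) }
  refine Subtype.ext (funext fun i => ?_)
  have h := (Finset.sum_eq_zero_iff_of_nonneg fun i _ => hnn (w.1 i)).1 w.2.1 i
    (Finset.mem_univ i)
  have h' : w.1 i * (w.1 i + 1) = 0 := by linarith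
  rcases mul_eq_zero.1 h' with h0 | h0
  · simp [h0]
  · simp [eq_neg_of_add_eq_zero_left h0, ZMod.val_one]

theorem syndrome_add (v w : Fin 16 → ℤ) : syndrome (v + w) = syndrome v + syndrome w := by
  simp [syndrome, add_smul, Finset.sum_add_distrib]

theorem syndrome_smul (c : ℤ) (w : Fin 16 → ℤ) : syndrome (c • w) = (c : ZMod 2) • syndrome w := by
  simp [syndrome, mul_smul, Finset.smul_sum]

theorem mem_span_rows_iff (v : Fin 16 → ℤ) :
    v ∈ Submodule.span ℤ (Set.range M4rows) ↔
      ∃ n : ℤ, ∃ w : Fin 16 → ℤ, syndrome w = 0 ∧ ∀ i, v i = n + 2 * w i := by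
  constructor
  · intro hv
    induction hv using Submodule.span_induction with
    | mem v hv =>
      obtain ⟨k, rfl⟩ := hv
      have h : ∀ k, syndrome (fun i => (M4rows k i - M4rows k 0) / 2) = 0 ∧
          ∀ i, M4rows k i = M4rows k 0 + 2 * ((M4rows k i - M4rows k 0) / 2) := by
        decide +kernel
      exact ⟨_, _, h k⟩
    | zero => exact ⟨0, 0, by simp [syndrome], by simp⟩
    | add v v' _ _ h h' =>
      obtain ⟨n, w, hw, hv⟩ := h
      obtain ⟨n', w', hw', hv'⟩ := h'
      refine ⟨n + n', w + w', by rw [syndrome_add, hw, hw', add_zero], fun i => ?_⟩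
      simp only [Pi.add_apply, hv, hv']
      ring
    | smul c v _ h =>
      obtain ⟨n, w, hw, hv⟩ := h
      refine ⟨c * n, c • w, by rw [syndrome_smul, hw, smul_zero], fun i => ?_⟩
      simp only [Pi.smul_apply, smul_eq_mul, hv]
      ring
  · rintro ⟨n, w, hw, hv⟩
    have hdvd (k : Fin 5) (m : ℤ) (hm : (m : ZMod 2) = syndrome w k) : ∃ q, m = 2 * q :=
      (ZMod.intCast_zmod_eq_zero_iff_dvd m 2).1 (by rw [hm, hw]; rfl)
    obtain ⟨a, ha⟩ := hdvd 0 (w 0 + w 1 + w 2 + w 3 + w 4 + w 5 + w 6 + w 7) (by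
      simp [syndrome, Fin.sum_univ_succ, checkColumn]; ring!)
    obtain ⟨b, hb⟩ := hdvd 1 (w 0 + w 1 + w 2 + w 3 + w 8 + w 9 + w 10 + w 11) (by
      simp [syndrome, Fin.sum_univ_succ, checkColumn]; ring!)
    obtain ⟨c, hc⟩ := hdvd 2 (w 0 + w 1 + w 4 + w 5 + w 8 + w 9 + w 12 + w 13) (by
      simp [syndrome, Fin.sum_univ_succ, checkColumn]; ring!)
    obtain ⟨d, hd⟩ := hdvd 3 (w 0 + w 2 + w 4 + w 6 + w 8 + w 10 + w 12 + w 14) (by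
      simp [syndrome, Fin.sum_univ_succ, checkColumn]; ring!)
    obtain ⟨e, he⟩ := hdvd 4 (w 0 + w 3 + w 5 + w 6 + w 9 + w 10 + w 12 + w 15) (by
      simp [syndrome, Fin.sum_univ_succ, checkColumn]; ring!)
    let u : Fin 16 → ℤ := fun i => w i - w 0
    refine Submodule.mem_span_range_iff_exists_fun ℤ |>.2
      ⟨![n + 2 * w 0, u 1, u 2, u 3, u 4, u 5, u 6,
        w 7 - a + 3 * w 0, u 8, u 9, u 10, w 11 - b + 3 * w 0, u 12,
        w 13 - c + 3 * w 0, w 14 - d + 3 * w 0, w 15 - e + 3 * w 0], ?_⟩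
    ext i
    fin_cases i <;> simp [Fin.sum_univ_succ, M4rows, hv, u] <;> linarith

theorem mem_lattice_iff (x : Fin 16 → ℚ) :
    (∃ v ∈ Submodule.span ℤ (Set.range fun i => fun j => (M4rows i j : ℚ)),
        x = (4 : ℚ)⁻¹ • v) ↔
      ∃ v ∈ Submodule.span ℤ (Set.range M4rows), x = fun i => (v i : ℚ) / 4 := by
  let f : (Fin 16 → ℤ) →ₗ[ℤ] (Fin 16 → ℚ) :=
    LinearMap.compLeft (Algebra.linearMap ℤ ℚ) (Fin 16)
  have hspan : Submodule.span ℤ (Set.range fun i => fun j => (M4rows i j : ℚ))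
      = (Submodule.span ℤ (Set.range M4rows)).map f := by
    rw [Submodule.map_span, ← Set.range_comp]
    rfl
  rw [hspan]
  constructor
  · rintro ⟨_, ⟨v, hv, rfl⟩, rfl⟩
    exact ⟨v, hv, by ext i; simp [f, div_eq_inv_mul]⟩
  · rintro ⟨v, hv, rfl⟩
    exact ⟨f v, ⟨v, hv, rfl⟩, by ext i; simp [f, div_eq_inv_mul]⟩

/-- The lattice vector with coordinates `(n + 2 wᵢ) / 4`. -/
def scaledWord (n : ℤ) (w : Fin 16 → ℤ) (i : Fin 16) : ℚ := ((n + 2 * w i : ℤ) : ℚ) / 4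

theorem scaledWord_apply_inj {n n' : ℤ} {w w' : Fin 16 → ℤ}
    (h : scaledWord n w = scaledWord n' w') (i : Fin 16) : n + 2 * w i = n' + 2 * w' i := by
  have hi := congrFun h i
  simp only [scaledWord] at hi
  exact_mod_cast (div_left_inj' (by norm_num : (4 : ℚ) ≠ 0)).1 hi

theorem sum_sq_scaledWord_eq_one_iff (n : ℤ) (w : Fin 16 → ℤ) :
    ∑ i, scaledWord n w i ^ 2 = 1 ↔ ∑ i, (n + 2 * w i) ^ 2 = 16 := by
  simp only [scaledWord, div_pow, ← Finset.sum_div]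
  rw [div_eq_one_iff_eq (by norm_num)]
  norm_num
  exact_mod_cast Iff.rfl

theorem stmt_12 :
    let L : Set (Fin 16 → ℚ) :=
      {x | ∃ v ∈ Submodule.span ℤ (Set.range fun i => fun j => (M4rows i j : ℚ)),
        x = (4 : ℚ)⁻¹ • v}
    Nat.card {x : Fin 16 → ℚ // x ∈ L ∧ ∑ i : Fin 16, (x i) ^ 2 = 1} = 4320 := by
  intro L
  have hone : ∑ i, (1 : ZMod 2) • checkColumn i = 0 := by decide +kernel
  have hmem (n : ℤ) (w : Fin 16 → ℤ) (hw : syndrome w = 0) : scaledWord n w ∈ L :=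
    (mem_lattice_iff _).2 ⟨_, (mem_span_rows_iff _).2 ⟨n, w, hw, fun _ => rfl⟩, rfl⟩
  have heven (w : Fin 16 → ℤ) : ∑ i, scaledWord 0 w i ^ 2 = 1 ↔ ∑ i, w i ^ 2 = 4 := by
    have h : ∑ i, (0 + 2 * w i) ^ 2 = 4 * ∑ i, w i ^ 2 := by
      rw [Finset.mul_sum]
      exact Finset.sum_congr rfl fun i _ => by ring
    rw [sum_sq_scaledWord_eq_one_iff, h]
    omega
  have hodd (w : Fin 16 → ℤ) : ∑ i, scaledWord 1 w i ^ 2 = 1 ↔ ∑ i, (w i ^ 2 + w i) = 0 := by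
    have h : ∑ i, (1 + 2 * w i) ^ 2 = 4 * ∑ i, (w i ^ 2 + w i) + 16 := by
      rw [Finset.mul_sum, show (16 : ℤ) = ∑ _i : Fin 16, 1 by simp, ← Finset.sum_add_distrib]
      exact Finset.sum_congr rfl fun i _ => by ring
    rw [sum_sq_scaledWord_eq_one_iff, h]
    omega
  let f : {w : Fin 16 → ℤ // ∑ i, w i ^ 2 = 4 ∧ syndrome w = 0} ⊕
      {w : Fin 16 → ℤ // ∑ i, (w i ^ 2 + w i) = 0 ∧ syndrome w = 0} →
      {x : Fin 16 → ℚ // x ∈ L ∧ ∑ i : Fin 16, (x i) ^ 2 = 1} :=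
    Sum.elim (fun w => ⟨scaledWord 0 w.1, hmem _ _ w.2.2, (heven _).2 w.2.1⟩)
      (fun w => ⟨scaledWord 1 w.1, hmem _ _ w.2.2, (hodd _).2 w.2.1⟩)
  have hf : Function.Bijective f := by
    constructor
    · rintro (w | w) (w' | w') h
      all_goals have h' := scaledWord_apply_inj (congrArg Subtype.val h)
      · exact congrArg Sum.inl (Subtype.ext (funext fun i => by have := h' i; omega))
      · have := h' 0
        omega
      · have := h' 0
        omega
      · exact congrArg Sum.inr (Subtype.ext (funext fun i => by have := h' i; omega))
    · rintro ⟨x, hx, hx1⟩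
      obtain ⟨v, hv, rfl⟩ := (mem_lattice_iff x).1 hx
      obtain ⟨n, w, hw, hnw⟩ := (mem_span_rows_iff v).1 hv
      have hshift (m : ℤ) : syndrome (w + m • 1) = 0 := by
        have h1 : syndrome 1 = 0 := by simpa [syndrome] using hone
        rw [syndrome_add, syndrome_smul, hw, h1, smul_zero, add_zero]
      have hx_eq (ε m : ℤ) (hn : n = 2 * m + ε) :
          (fun i => (v i : ℚ) / 4) = scaledWord ε (w + m • 1) := by
        ext i
        simp only [scaledWord, hnw i, hn, Pi.add_apply, Pi.smul_apply, Pi.one_apply, smul_eq_mul]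
        congr 2
        ring
      rcases Int.even_or_odd' n with ⟨m, hn | hn⟩
      · have he := hx_eq 0 m (by omega)
        exact ⟨Sum.inl ⟨w + m • 1, (heven _).1 (he ▸ hx1), hshift m⟩, Subtype.ext he.symm⟩
      · have he := hx_eq 1 m hn
        exact ⟨Sum.inr ⟨w + m • 1, (hodd _).1 (he ▸ hx1), hshift m⟩, Subtype.ext he.symm⟩
  have : Finite {w : Fin 16 → ℤ // ∑ i, w i ^ 2 = 4 ∧ syndrome w = 0} :=
    Nat.finite_of_card_ne_zero (by rw [card_even_words]; norm_num)
  have : Finite {w : Fin 16 → ℤ // ∑ i, (w i ^ 2 + w i) = 0 ∧ syndrome w = 0} :=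
    Nat.finite_of_card_ne_zero (by rw [card_odd_words]; norm_num)
  rw [← Nat.card_congr (Equiv.ofBijective f hf), Nat.card_sum, card_even_words, card_odd_words]
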